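/- arXiv:1104.2406 — 5 statements merged into one kernel-verified Lean document; each statement's English description precedes it below -/
import Mathlib

section
/- Let E and F be complex Hilbert spaces and let T be a closed, densely defined linear operator from E to F, with Hilbert-space adjoint T*. Let g ∈ F, let δ > 0 and C ≥ 0, and assume that for every u in the domain of T* one has |⟨g, u⟩|² ≤ C·(‖T* u‖² + δ‖u‖²). Then there exist v in the domain of T and w ∈ F such that T v + √δ · w = g and ‖v‖² + ‖w‖² ≤ C. -/
open scoped InnerProductSpace

/-- For a closed operator `T` and `s > 0`, the vector `s⁻¹ • g` splits orthogonally along the graph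
of `s⁻¹ • T`: there is `v` in the domain with `T v + s • w = g` such that `(-v, w)` is orthogonal
to that graph. -/
theorem LinearPMap.IsClosed.exists_add_smul_eq_and_inner_eq
    {E F : Type*}
    [NormedAddCommGroup E] [InnerProductSpace ℂ E] [CompleteSpace E]
    [NormedAddCommGroup F] [InnerProductSpace ℂ F] [CompleteSpace F]
    {T : E →ₗ.[ℂ] F} (hT : T.IsClosed) (g : F) {s : ℝ} (hs : 0 < s) :
    ∃ v : T.domain, ∃ w : F, T v + s • w = g ∧
      ∀ x : T.domain, ⟪s • (v : E), (x : E)⟫_ℂ = ⟪w, T x⟫_ℂ := by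
  let L : WithLp 2 (E × F) →L[ℂ] E × F :=
    (WithLp.fstL 2 ℂ E F).prod ((s : ℂ) • WithLp.sndL 2 ℂ E F)
  let K : Submodule ℂ (WithLp 2 (E × F)) := T.graph.comap L.toLinearMap
  have hK : _root_.IsClosed (K : Set (WithLp 2 (E × F))) := _root_.IsClosed.preimage L.continuous hT
  have : CompleteSpace K := hK.completeSpace_coe
  have hsc : (s : ℂ) ≠ 0 := by exact_mod_cast hs.ne'
  obtain ⟨p, hp, q, hq, hpq⟩ :=
    K.exists_add_mem_mem_orthogonal (WithLp.toLp 2 ((0 : E), (s : ℂ)⁻¹ • g))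
  have h_fst : p.fst + q.fst = 0 := (congrArg WithLp.fst hpq).symm
  have h_snd : p.snd + q.snd = (s : ℂ)⁻¹ • g := (congrArg WithLp.snd hpq).symm
  obtain ⟨v, hv, hTv⟩ := T.mem_graph_iff.mp (show (p.fst, (s : ℂ) • p.snd) ∈ T.graph from hp)
  refine ⟨v, q.snd, ?_, fun x => ?_⟩
  · rw [hTv, ← Complex.coe_smul, ← smul_add, h_snd, smul_inv_smul₀ hsc]
  · have hx : WithLp.toLp 2 ((x : E), (s : ℂ)⁻¹ • T x) ∈ K := by
      change ((x : E), (s : ℂ) • (s : ℂ)⁻¹ • T x) ∈ T.graph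
      rw [smul_inv_smul₀ hsc]
      exact T.mem_graph x
    have h_inner := K.inner_left_of_mem_orthogonal hx hq
    have hq_fst : q.fst = -(v : E) := by
      rw [hv]
      exact eq_neg_of_add_eq_zero_right h_fst
    simp only [WithLp.prod_inner_apply, WithLp.ofLp_fst, WithLp.ofLp_snd, hq_fst, inner_neg_left,
      inner_smul_right] at h_inner
    rw [← Complex.coe_smul, inner_smul_left, Complex.conj_ofReal]
    field_simp at h_inner
    linear_combination -h_inner

/-- **Abstract solvability with error term.**
Let `E` and `F` be complex Hilbert spaces and `T` a closed, densely defined linear operator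
from `E` to `F`, with Hilbert-space adjoint `T†`. If `g ∈ F`, `δ > 0`, `C ≥ 0` and
`|⟪g, u⟫|² ≤ C·(‖T† u‖² + δ‖u‖²)` for every `u` in the domain of `T†`, then there are
`v` in the domain of `T` and `w ∈ F` with `T v + √δ·w = g` and `‖v‖² + ‖w‖² ≤ C`. -/
theorem abstract_solvability_with_error
    {E F : Type*}
    [NormedAddCommGroup E] [InnerProductSpace ℂ E] [CompleteSpace E]
    [NormedAddCommGroup F] [InnerProductSpace ℂ F] [CompleteSpace F]
    (T : E →ₗ.[ℂ] F) (hTdense : Dense (T.domain : Set E)) (hTclosed : T.IsClosed)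
    (g : F) (δ C : ℝ) (hδ : 0 < δ) (hC : 0 ≤ C)
    (hbound : ∀ u : T.adjoint.domain,
      ‖⟪g, (u : F)⟫_ℂ‖ ^ 2 ≤ C * (‖T.adjoint u‖ ^ 2 + δ * ‖(u : F)‖ ^ 2)) :
    ∃ v : T.domain, ∃ w : F,
      T v + Real.sqrt δ • w = g ∧ ‖(v : E)‖ ^ 2 + ‖w‖ ^ 2 ≤ C := by
  have hs : 0 < Real.sqrt δ := Real.sqrt_pos.mpr hδ
  have hs_sq : Real.sqrt δ ^ 2 = δ := Real.sq_sqrt hδ.le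
  obtain ⟨v, w, hvw, h_inner⟩ := hTclosed.exists_add_smul_eq_and_inner_eq g hs
  refine ⟨v, w, hvw, ?_⟩
  have hw : w ∈ T.adjoint.domain := LinearPMap.mem_adjoint_domain_of_exists w ⟨_, h_inner⟩
  have h_adj : T.adjoint ⟨w, hw⟩ = Real.sqrt δ • (v : E) :=
    LinearPMap.adjoint_apply_eq hTdense ⟨w, hw⟩ h_inner
  have h_norm : ‖⟪g, w⟫_ℂ‖ = Real.sqrt δ * (‖(v : E)‖ ^ 2 + ‖w‖ ^ 2) := by
    have h_eq : ⟪w, g⟫_ℂ = ((Real.sqrt δ * (‖(v : E)‖ ^ 2 + ‖w‖ ^ 2) : ℝ) : ℂ) := by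
      rw [← hvw, inner_add_right, ← h_inner v, ← Complex.coe_smul, ← Complex.coe_smul,
        inner_smul_left, inner_smul_right, Complex.conj_ofReal, inner_self_eq_norm_sq_to_K,
        inner_self_eq_norm_sq_to_K]
      simp only [Complex.coe_algebraMap, Complex.ofReal_mul, Complex.ofReal_add, Complex.ofReal_pow]
      ring
    rw [norm_inner_symm, h_eq, Complex.norm_of_nonneg (by positivity)]
  have h := hbound ⟨w, hw⟩
  simp only [h_adj, h_norm, norm_smul, Real.norm_of_nonneg hs.le, mul_pow, hs_sq] at h
  by_contra! hlt
  have hpos := hC.trans_lt hlt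
  nlinarith [mul_pos (mul_pos hδ hpos) (sub_pos.mpr hlt)]
end

section
/- Let E, F and G be complex Hilbert spaces, let T be a closed, densely defined linear operator from E to F with Hilbert-space adjoint T*, let R : F → G be a bounded linear operator, and let δ > 0. Assume that for every u in the domain of T* one has ‖R u‖² ≤ ‖T* u‖² + δ‖u‖². Then for every g₀ ∈ G and g₁ ∈ F, setting g := R* g₀ + g₁ (where R* is the adjoint of R), there exist v in the domain of T and w ∈ F such that T v + √δ · w = g and ‖v‖² + ‖w‖² ≤ 2(‖g₀‖² + δ⁻¹‖g₁‖²). -/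
open scoped InnerProductSpace

/-- For a closed operator `T` and `s ≠ 0`, the equation `T v + s w = g` has a solution
orthogonal to the solutions of the homogeneous equation; for it, `w` lies in the domain of `T†`
and `T† w = s v`. -/
theorem LinearPMap.IsClosed.exists_minimal_solution {E F : Type*}
    [NormedAddCommGroup E] [InnerProductSpace ℂ E] [CompleteSpace E]
    [NormedAddCommGroup F] [InnerProductSpace ℂ F] [CompleteSpace F]
    {T : E →ₗ.[ℂ] F} (hT : T.IsClosed) {s : ℝ} (hs : s ≠ 0) (g : F) :
    ∃ v : T.domain, ∃ w : F, T v + (s : ℂ) • w = g ∧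
      ∀ x : T.domain, ⟪(s : ℂ) • (v : E), (x : E)⟫_ℂ = ⟪w, T x⟫_ℂ := by
  have hs' : (s : ℂ) ≠ 0 := by exact_mod_cast hs
  let L : WithLp 2 (E × F) →L[ℂ] E × F :=
    (WithLp.fstL 2 ℂ E F).prod (-(s : ℂ) • WithLp.sndL 2 ℂ E F)
  let K : Submodule ℂ (WithLp 2 (E × F)) := T.graph.comap L.toLinearMap
  have hK : _root_.IsClosed (K : Set (WithLp 2 (E × F))) := IsClosed.preimage L.continuous hT
  have : CompleteSpace K := hK.completeSpace_coe
  let q : WithLp 2 (E × F) := WithLp.toLp 2 (0, (s : ℂ)⁻¹ • g)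
  obtain ⟨k, hk, hkq⟩ : ∃ k ∈ K, q - k ∈ Kᗮ :=
    ⟨K.starProjection q, K.starProjection_apply_mem q, K.sub_starProjection_mem_orthogonal q⟩
  obtain ⟨y, hy₁, hy₂⟩ := (LinearPMap.mem_graph_iff T).1 (show L k ∈ T.graph from hk)
  replace hy₁ : (y : E) = k.fst := hy₁
  replace hy₂ : T y = -(s : ℂ) • k.snd := hy₂
  refine ⟨-y, (s : ℂ)⁻¹ • g - k.snd, ?_, fun x => ?_⟩
  · rw [LinearPMap.map_neg, hy₂, smul_sub, smul_inv_smul₀ hs']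
    module
  · have hx : WithLp.toLp 2 ((x : E), -(s : ℂ)⁻¹ • T x) ∈ K := by
      refine (LinearPMap.mem_graph_iff T).2 ⟨x, rfl, ?_⟩
      change T x = -(s : ℂ) • (-(s : ℂ)⁻¹ • T x)
      rw [smul_smul, neg_mul_neg, mul_inv_cancel₀ hs', one_smul]
    have h := Submodule.inner_left_of_mem_orthogonal hx hkq
    rw [WithLp.prod_inner_apply] at h
    simp only [q, WithLp.ofLp_sub, Prod.fst_sub, Prod.snd_sub, inner_smul_right, zero_sub] at h
    change ⟪-k.fst, (x : E)⟫_ℂ + -(s : ℂ)⁻¹ * ⟪(s : ℂ)⁻¹ • g - k.snd, T x⟫_ℂ = 0 at h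
    rw [← hy₁] at h
    rw [inner_smul_left, Complex.conj_ofReal, NegMemClass.coe_neg, eq_neg_of_add_eq_zero_left h]
    field_simp

/-- **Abstract a priori estimate and solvability (relations (14)–(15)).**
Let `E`, `F`, `G` be complex Hilbert spaces, `T` a closed densely defined operator from `E`
to `F` with adjoint `T†`, `R : F → G` bounded, `δ > 0`. If `‖R u‖² ≤ ‖T† u‖² + δ‖u‖²` for
every `u` in the domain of `T†`, then for all `g₀ ∈ G`, `g₁ ∈ F` and `g := R* g₀ + g₁`
there are `v` in the domain of `T` and `w ∈ F` with `T v + √δ·w = g` and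
`‖v‖² + ‖w‖² ≤ 2(‖g₀‖² + δ⁻¹‖g₁‖²)`. -/
theorem abstract_apriori_solvability
    {E F G : Type*}
    [NormedAddCommGroup E] [InnerProductSpace ℂ E] [CompleteSpace E]
    [NormedAddCommGroup F] [InnerProductSpace ℂ F] [CompleteSpace F]
    [NormedAddCommGroup G] [InnerProductSpace ℂ G] [CompleteSpace G]
    (T : E →ₗ.[ℂ] F) (hTdense : Dense (T.domain : Set E)) (hTclosed : T.IsClosed)
    (R : F →L[ℂ] G) (δ : ℝ) (hδ : 0 < δ)
    (hbound : ∀ u : T.adjoint.domain,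
      ‖R (u : F)‖ ^ 2 ≤ ‖T.adjoint u‖ ^ 2 + δ * ‖(u : F)‖ ^ 2)
    (g₀ : G) (g₁ : F) :
    ∃ v : T.domain, ∃ w : F,
      T v + Real.sqrt δ • w = ContinuousLinearMap.adjoint R g₀ + g₁ ∧
      ‖(v : E)‖ ^ 2 + ‖w‖ ^ 2 ≤ 2 * (‖g₀‖ ^ 2 + δ⁻¹ * ‖g₁‖ ^ 2) := by
  set s := Real.sqrt δ
  have hs : 0 < s := Real.sqrt_pos.2 hδ
  have hsq : s ^ 2 = δ := Real.sq_sqrt hδ.le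
  obtain ⟨v, w, hvw, horth⟩ :=
    hTclosed.exists_minimal_solution hs.ne' (ContinuousLinearMap.adjoint R g₀ + g₁)
  refine ⟨v, w, by simpa using hvw, ?_⟩
  have hw : w ∈ T.adjoint.domain := LinearPMap.mem_adjoint_domain_of_exists w ⟨_, horth⟩
  have hTw : T.adjoint ⟨w, hw⟩ = (s : ℂ) • (v : E) :=
    LinearPMap.adjoint_apply_eq hTdense ⟨w, hw⟩ horth
  have hR : ‖R w‖ ^ 2 ≤ s ^ 2 * (‖(v : E)‖ ^ 2 + ‖w‖ ^ 2) := by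
    have h := hbound ⟨w, hw⟩
    rw [hTw, norm_smul, Complex.norm_real, Real.norm_of_nonneg hs.le, mul_pow] at h
    simp only [← hsq] at h
    linarith
  have henergy : s * (‖(v : E)‖ ^ 2 + ‖w‖ ^ 2) = (⟪R w, g₀⟫_ℂ + ⟪w, g₁⟫_ℂ).re := by
    have h := horth v
    rw [eq_sub_of_add_eq hvw, inner_sub_right, inner_add_right,
      ContinuousLinearMap.adjoint_inner_right, inner_smul_left, inner_smul_right,
      Complex.conj_ofReal, inner_self_eq_norm_sq_to_K, inner_self_eq_norm_sq_to_K] at h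
    rw [← eq_sub_iff_add_eq.1 h, ← mul_add]
    simp [← Complex.ofReal_pow, ← Complex.ofReal_add, ← Complex.ofReal_mul]
  set N := Real.sqrt (‖(v : E)‖ ^ 2 + ‖w‖ ^ 2)
  have hN : N ^ 2 = ‖(v : E)‖ ^ 2 + ‖w‖ ^ 2 := Real.sq_sqrt (by positivity)
  have hN0 : 0 ≤ N := Real.sqrt_nonneg _
  have hRN : ‖R w‖ ≤ s * N :=
    pow_le_pow_iff_left₀ (norm_nonneg _) (by positivity) two_ne_zero |>.1 (by rwa [mul_pow, hN])
  have hwN : ‖w‖ ≤ N := Real.le_sqrt_of_sq_le (by nlinarith [sq_nonneg ‖(v : E)‖])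
  have hup : s * N ^ 2 ≤ s * N * ‖g₀‖ + N * ‖g₁‖ := by
    rw [hN, henergy, Complex.add_re]
    gcongr
    · exact (re_inner_le_norm (𝕜 := ℂ) _ _).trans (by gcongr)
    · exact (re_inner_le_norm (𝕜 := ℂ) _ _).trans (by gcongr)
  have hNle : N ≤ ‖g₀‖ + s⁻¹ * ‖g₁‖ := by
    rcases hN0.eq_or_lt with h | h
    · rw [← h]; positivity
    · refine le_of_mul_le_mul_left (a := s * N) ?_ (by positivity)
      calc s * N * N = s * N ^ 2 := by ring
        _ ≤ s * N * ‖g₀‖ + N * ‖g₁‖ := hup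
        _ = s * N * (‖g₀‖ + s⁻¹ * ‖g₁‖) := by field_simp
  calc ‖(v : E)‖ ^ 2 + ‖w‖ ^ 2 = N ^ 2 := hN.symm
    _ ≤ (‖g₀‖ + s⁻¹ * ‖g₁‖) ^ 2 := by gcongr
    _ ≤ 2 * (‖g₀‖ ^ 2 + (s⁻¹ * ‖g₁‖) ^ 2) := add_sq_le
    _ = 2 * (‖g₀‖ ^ 2 + δ⁻¹ * ‖g₁‖ ^ 2) := by rw [mul_pow, inv_pow, hsq]
end

section
/- There exists a constant C > 0 such that for every ε with 0 < ε ≤ 1/2 one has ∫_{{z ∈ ℂ : |z| < ε}} 1/((|z|² + ε²)·(log(|z|² + ε²))²) dλ(z) ≤ C / log(1/ε²), where dλ denotes the Lebesgue (area) measure on ℂ. -/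
open MeasureTheory

/-- **Second Hölder factor estimate (relation (37)).**
There is `C > 0` such that for all `0 < ε ≤ 1/2`,
`∫_{|z|<ε} dλ(z)/((|z|²+ε²)·log²(|z|²+ε²)) ≤ C / log(1/ε²)`, where `λ` is the Lebesgue
(area) measure on `ℂ`. -/
theorem smallDisc_inverse_log_estimate :
    ∃ C : ℝ, 0 < C ∧ ∀ ε : ℝ, 0 < ε → ε ≤ 1 / 2 →
      ∫ z in Metric.ball (0 : ℂ) ε,
          1 / ((‖z‖ ^ 2 + ε ^ 2) * (Real.log (‖z‖ ^ 2 + ε ^ 2)) ^ 2)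
        ≤ C / Real.log (1 / ε ^ 2) := by
  refine ⟨4 * Real.pi, by positivity, fun ε hε hε2 => ?_⟩
  have hlog : Real.log ε ≤ -(1 / 2) := by
    have h1 := Real.log_le_log hε hε2
    have h2 : Real.log (1 / 2) = -Real.log 2 := by rw [one_div, Real.log_inv]
    linarith [Real.log_two_gt_d9]
  have hL : Real.log (1 / ε ^ 2) = -(2 * Real.log ε) := by
    rw [one_div, Real.log_inv, Real.log_pow]
    norm_num
  have hbound : ∀ z ∈ Metric.ball (0 : ℂ) ε,
      ‖1 / ((‖z‖ ^ 2 + ε ^ 2) * (Real.log (‖z‖ ^ 2 + ε ^ 2)) ^ 2)‖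
        ≤ 1 / (ε ^ 2 * (Real.log ε) ^ 2) := by
    intro z hz
    rw [mem_ball_zero_iff] at hz
    have hw : ‖z‖ ^ 2 + ε ^ 2 ≤ ε := by nlinarith [norm_nonneg z]
    have hw0 : 0 < ‖z‖ ^ 2 + ε ^ 2 := by positivity
    have hlw := Real.log_le_log hw0 hw
    have hsq : (Real.log ε) ^ 2 ≤ (Real.log (‖z‖ ^ 2 + ε ^ 2)) ^ 2 := by nlinarith
    have hl0 : 0 < (Real.log ε) ^ 2 := by nlinarith
    rw [Real.norm_of_nonneg (by positivity)]
    exact one_div_le_one_div_of_le (by positivity)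
      (mul_le_mul (by nlinarith [norm_nonneg z]) hsq hl0.le hw0.le)
  have hvol : volume.real (Metric.ball (0 : ℂ) ε) = Real.pi * ε ^ 2 := by
    simp [Measure.real, Complex.volume_ball, hε.le, mul_comm]
  calc
    _ ≤ 1 / (ε ^ 2 * (Real.log ε) ^ 2) * volume.real (Metric.ball (0 : ℂ) ε) :=
      (Real.le_norm_self _).trans
        (norm_setIntegral_le_of_norm_le_const measure_ball_lt_top hbound)
    _ = Real.pi / (Real.log ε) ^ 2 := by
      rw [hvol]
      field_simp
    _ ≤ 4 * Real.pi / Real.log (1 / ε ^ 2) := by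
      rw [hL, div_le_div_iff₀ (by nlinarith) (by linarith)]
      have h : -(2 * Real.log ε) ≤ 4 * (Real.log ε) ^ 2 := by nlinarith
      nlinarith [mul_le_mul_of_nonneg_left h Real.pi_pos.le]
end

section
/- Let Ω ⊆ ℂ be open, let f : ℂ → ℂ be holomorphic on Ω, let ε > 0, and define σ : Ω → ℝ by σ(z) = log(ε² + |f(z)|²). Identify ℂ with ℝ² and let Δσ(z) denote the sum of the two second directional derivatives of σ at z in the directions 1 and i (the real Laplacian). Then: (a) Δσ(z) ≥ 0 for every z ∈ Ω; (b) for every z ∈ Ω with f(z) ≠ 0, Δσ(z) = (ε²/|f(z)|²) · ‖Dσ(z)‖², where Dσ(z) is the real Fréchet derivative of σ at z and ‖Dσ(z)‖ its operator norm. -/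
open scoped ComplexConjugate

lemma hasDerivAt_comp_line {g : ℂ → ℂ} {g' z : ℂ} (hg : HasDerivAt g g' z) (v : ℂ) :
    HasDerivAt (fun t : ℝ => g (z + t • v)) (g' * v) 0 := by
  have hline : HasDerivAt (fun t : ℝ => z + t • v) v 0 := by
    simpa using ((hasDerivAt_id (0 : ℝ)).smul_const v).const_add z
  have hg0 : HasDerivAt g g' (z + (0 : ℝ) • v) := by simpa using hg
  exact hg0.comp (0 : ℝ) hline

/-- The first directional derivative of `log (ε² + ‖f‖²)` at a point of complex
differentiability. -/
lemma hasLineDerivAt_log_sq_add_norm_sq {f : ℂ → ℂ} {f' z : ℂ} (hf : HasDerivAt f f' z)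
    {ε : ℝ} (hε : 0 < ε) (v : ℂ) :
    HasLineDerivAt ℝ (fun w => Real.log (ε ^ 2 + ‖f w‖ ^ 2))
      (2 * inner ℝ (f z) (f' * v) / (ε ^ 2 + ‖f z‖ ^ 2)) z v := by
  have h := ((hasDerivAt_comp_line hf v).norm_sq.const_add (ε ^ 2)).log (by positivity)
  simpa [HasLineDerivAt] using h

/-- The derivative, along `v`, of the first directional derivative of `log (ε² + ‖f‖²)`. -/
lemma hasLineDerivAt_two_mul_inner_div {f g : ℂ → ℂ} {g' z : ℂ} (hf : HasDerivAt f (g z) z)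
    (hg : HasDerivAt g g' z) {ε : ℝ} (hε : 0 < ε) (v : ℂ) :
    HasLineDerivAt ℝ (fun w => 2 * inner ℝ (f w) (g w * v) / (ε ^ 2 + ‖f w‖ ^ 2))
      (2 * (‖g z * v‖ ^ 2 + inner ℝ (f z) (g' * v ^ 2)) / (ε ^ 2 + ‖f z‖ ^ 2) -
        (2 * inner ℝ (f z) (g z * v) / (ε ^ 2 + ‖f z‖ ^ 2)) ^ 2) z v := by
  have hF := hasDerivAt_comp_line hf v
  have hG := (hasDerivAt_comp_line hg v).mul_const v
  have hD : ε ^ 2 + ‖f z‖ ^ 2 ≠ 0 := by positivity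
  have h := ((hF.inner ℝ hG).const_mul 2).div (hF.norm_sq.const_add (ε ^ 2)) (by positivity)
  refine HasDerivAt.congr_deriv h ?_
  simp only [zero_smul, add_zero, real_inner_self_eq_norm_sq, mul_assoc, ← pow_two]
  field_simp
  ring

/-- The real derivative of `log (ε² + ‖f‖²)` has operator norm `2 ‖f‖ ‖f'‖ / (ε² + ‖f‖²)`. -/
lemma norm_fderiv_log_sq_add_norm_sq {f : ℂ → ℂ} {f' z : ℂ} (hf : HasDerivAt f f' z)
    {ε : ℝ} (hε : 0 < ε) :
    ‖fderiv ℝ (fun w => Real.log (ε ^ 2 + ‖f w‖ ^ 2)) z‖ =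
      2 * ‖f z‖ * ‖f'‖ / (ε ^ 2 + ‖f z‖ ^ 2) := by
  have hdiff : DifferentiableAt ℝ (fun w => Real.log (ε ^ 2 + ‖f w‖ ^ 2)) z :=
    ((hf.differentiableAt.restrictScalars ℝ).norm_sq ℝ |>.const_add (ε ^ 2)).log (by positivity)
  have h : fderiv ℝ (fun w => Real.log (ε ^ 2 + ‖f w‖ ^ 2)) z =
      (2 / (ε ^ 2 + ‖f z‖ ^ 2)) • innerSL ℝ (conj f' * f z) := by
    ext1 v
    rw [← hdiff.lineDeriv_eq_fderiv, (hasLineDerivAt_log_sq_add_norm_sq hf hε v).lineDeriv]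
    simp [Complex.inner]
    ring
  rw [h, norm_smul, innerSL_apply_norm, norm_mul, RCLike.norm_conj,
    Real.norm_of_nonneg (by positivity)]
  ring


/-- **One-variable model of the curvature inequality (17).**
Let `Ω ⊆ ℂ` be open, `f` holomorphic on `Ω`, `ε > 0`, and
`σ(z) = log(ε² + |f(z)|²)`. Let `Δσ(z)` be the sum of the second directional derivatives
of `σ` at `z` in the real directions `1` and `i`. Then `Δσ ≥ 0` on `Ω`, and at points
where `f(z) ≠ 0`, `Δσ(z) = (ε²/|f(z)|²)·‖Dσ(z)‖²` with `Dσ(z)` the real Fréchet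
derivative of `σ` at `z`. -/
theorem laplacian_log_eps_sq_abs_sq
    (Ω : Set ℂ) (hΩ : IsOpen Ω) (f : ℂ → ℂ) (hf : DifferentiableOn ℂ f Ω)
    (ε : ℝ) (hε : 0 < ε)
    (σ : ℂ → ℝ) (hσ : ∀ z, σ z = Real.log (ε ^ 2 + ‖f z‖ ^ 2))
    (Δσ : ℂ → ℝ)
    (hΔσ : ∀ z, Δσ z =
      lineDeriv ℝ (fun w => lineDeriv ℝ σ w 1) z 1 +
      lineDeriv ℝ (fun w => lineDeriv ℝ σ w Complex.I) z Complex.I) :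
    (∀ z ∈ Ω, 0 ≤ Δσ z) ∧
    (∀ z ∈ Ω, f z ≠ 0 → Δσ z = ε ^ 2 / ‖f z‖ ^ 2 * ‖fderiv ℝ σ z‖ ^ 2) := by
  obtain rfl : σ = fun z => Real.log (ε ^ 2 + ‖f z‖ ^ 2) := funext hσ
  have hderiv : ∀ z ∈ Ω, HasDerivAt f (deriv f z) z := fun z hz =>
    (hf.differentiableAt (hΩ.mem_nhds hz)).hasDerivAt
  have hsecond : ∀ z ∈ Ω, ∀ v : ℂ,
      lineDeriv ℝ (fun w => lineDeriv ℝ (fun z => Real.log (ε ^ 2 + ‖f z‖ ^ 2)) w v) z v =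
        2 * (‖deriv f z * v‖ ^ 2 + inner ℝ (f z) (deriv (deriv f) z * v ^ 2)) /
          (ε ^ 2 + ‖f z‖ ^ 2) -
        (2 * inner ℝ (f z) (deriv f z * v) / (ε ^ 2 + ‖f z‖ ^ 2)) ^ 2 := by
    intro z hz v
    have hfirst : (fun w => lineDeriv ℝ (fun z => Real.log (ε ^ 2 + ‖f z‖ ^ 2)) w v) =ᶠ[nhds z]
        fun w => 2 * inner ℝ (f w) (deriv f w * v) / (ε ^ 2 + ‖f w‖ ^ 2) := by
      filter_upwards [hΩ.mem_nhds hz] with w hw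
      exact (hasLineDerivAt_log_sq_add_norm_sq (hderiv w hw) hε v).lineDeriv
    rw [hfirst.lineDeriv_eq]
    exact (hasLineDerivAt_two_mul_inner_div (hderiv z hz)
      ((hf.deriv hΩ).differentiableAt (hΩ.mem_nhds hz)).hasDerivAt hε v).lineDeriv
  have hlaplacian : ∀ z ∈ Ω,
      Δσ z = 4 * ε ^ 2 * ‖deriv f z‖ ^ 2 / (ε ^ 2 + ‖f z‖ ^ 2) ^ 2 := by
    intro z hz
    have hD : ε ^ 2 + ‖f z‖ ^ 2 ≠ 0 := by positivity
    have hsum : (inner ℝ (f z) (deriv f z * 1)) ^ 2 +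
        (inner ℝ (f z) (deriv f z * Complex.I)) ^ 2 = ‖f z‖ ^ 2 * ‖deriv f z‖ ^ 2 := by
      simp only [Complex.inner, Complex.sq_norm, Complex.normSq_apply, Complex.mul_re,
        Complex.mul_im, Complex.conj_re, Complex.conj_im, Complex.I_re, Complex.I_im,
        Complex.one_re, Complex.one_im]
      ring
    rw [hΔσ, hsecond z hz, hsecond z hz]
    have hI : inner ℝ (f z) (deriv (deriv f) z * Complex.I ^ 2) =
        -inner ℝ (f z) (deriv (deriv f) z * 1 ^ 2) := by
      simp
    rw [hI, norm_mul, norm_mul, Complex.norm_I, norm_one]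
    field_simp
    rw [mul_one] at hsum
    linear_combination (-4) * hsum
  refine ⟨fun z hz => ?_, fun z hz hfz => ?_⟩
  · rw [hlaplacian z hz]
    positivity
  · rw [hlaplacian z hz, norm_fderiv_log_sq_add_norm_sq (hderiv z hz) hε]
    have hD : ε ^ 2 + ‖f z‖ ^ 2 ≠ 0 := by positivity
    have hfz' : ‖f z‖ ≠ 0 := norm_ne_zero_iff.mpr hfz
    field_simp
    ring
end

section
/- Let ε₀ > 0. Then there exists a constant C > 0 (depending only on ε₀) with the following property: for every M ≥ 0, every measurable function g : ℂ → ℂ with |g(z)| ≤ M for all |z| < 1/2, every measurable function φ : ℂ → ℝ such that A := ∫_{{|z| < 1/2}} |g(z)|² e^{−(1+ε₀)φ(z)} / (log(1/|z|²))² dλ(z) is finite, and every ε with 0 < ε ≤ 1/4, one has ∫_{{|z| < ε}} |g(z)|² e^{−φ(z)} dλ(z) ≤ A^{1/(1+ε₀)} · (C · M² · ε² · (log(1/ε²))^{2/ε₀})^{ε₀/(1+ε₀)}. -/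
open MeasureTheory
open scoped ENNReal

/-- `(1 + 2 log s)^a` grows at most linearly in `s ≥ 1`. -/
theorem one_add_two_mul_log_rpow_le {a s : ℝ} (ha : 0 < a) (hs : 1 ≤ s) :
    (1 + 2 * Real.log s) ^ a ≤ (1 + 2 * a) ^ a * s := by
  have hs0 : 0 < s := by linarith
  have hlog : 0 ≤ Real.log s := Real.log_nonneg hs
  have h1 : Real.log s ≤ s ^ (1 / a) / (1 / a) :=
    Real.log_le_rpow_div hs0.le (by positivity)
  have h2 : 1 ≤ s ^ (1 / a) := Real.one_le_rpow hs (by positivity)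
  have h3 : s ^ (1 / a) / (1 / a) = a * s ^ (1 / a) := by field_simp
  calc (1 + 2 * Real.log s) ^ a ≤ ((1 + 2 * a) * s ^ (1 / a)) ^ a := by
        apply Real.rpow_le_rpow (by positivity) _ ha.le
        rw [h3] at h1
        linarith
    _ = (1 + 2 * a) ^ a * s := by
        rw [Real.mul_rpow (by positivity) (by positivity), ← Real.rpow_mul hs0.le,
          one_div_mul_cancel ha.ne', Real.rpow_one]

theorem one_le_log_one_div_sq {r : ℝ} (hr : 0 < r) (hr' : r ≤ 1 / 4) :
    1 ≤ Real.log (1 / r ^ 2) := by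
  rw [Real.le_log_iff_exp_le (by positivity)]
  have h := Real.exp_one_lt_d9
  have h1 : r ^ 2 ≤ 1 / 16 := by nlinarith
  have h2 : (16 : ℝ) ≤ 1 / r ^ 2 := by
    rw [le_div_iff₀ (by positivity)]
    linarith
  linarith

theorem log_one_div_sq_rpow_le {a r t : ℝ} (ha : 0 < a) (ht : 0 < t) (htr : t ≤ r)
    (hr : r ≤ 1 / 4) :
    Real.log (1 / t ^ 2) ^ a ≤ (1 + 2 * a) ^ a * Real.log (1 / r ^ 2) ^ a * (r / t) := by
  have hr0 : 0 < r := ht.trans_le htr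
  have hs : 1 ≤ r / t := (one_le_div ht).2 htr
  have hL : 1 ≤ Real.log (1 / r ^ 2) := one_le_log_one_div_sq hr0 hr
  have hl : 0 ≤ Real.log (r / t) := Real.log_nonneg hs
  have heq : Real.log (1 / t ^ 2) = Real.log (1 / r ^ 2) + 2 * Real.log (r / t) := by
    rw [one_div, one_div, Real.log_inv, Real.log_inv, Real.log_pow, Real.log_pow,
      Real.log_div hr0.ne' ht.ne']
    push_cast
    ring
  calc Real.log (1 / t ^ 2) ^ a
      ≤ (Real.log (1 / r ^ 2) * (1 + 2 * Real.log (r / t))) ^ a := by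
        rw [heq]
        apply Real.rpow_le_rpow (by positivity) _ ha.le
        nlinarith
    _ = Real.log (1 / r ^ 2) ^ a * (1 + 2 * Real.log (r / t)) ^ a :=
        Real.mul_rpow (by positivity) (by positivity)
    _ ≤ Real.log (1 / r ^ 2) ^ a * ((1 + 2 * a) ^ a * (r / t)) := by
        gcongr
        exact one_add_two_mul_log_rpow_le ha hs
    _ = _ := by ring

theorem lintegral_ball_inv_norm_le {r : ℝ} (hr : 0 < r) :
    ∫⁻ z in Metric.ball (0 : ℂ) r, ENNReal.ofReal (r / ‖z‖)
      ≤ ENNReal.ofReal (2 * Real.pi * r ^ 2) := by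
  rw [← lintegral_indicator Metric.isOpen_ball.measurableSet,
    ← Complex.lintegral_comp_polarCoord_symm]
  calc _ ≤ ∫⁻ p in polarCoord.target,
          (Set.Ioo 0 r ×ˢ Set.Ioo (-Real.pi) Real.pi).indicator
            (fun _ => ENNReal.ofReal r) p := by
        refine setLIntegral_mono_ae' polarCoord.open_target.measurableSet
          (Filter.Eventually.of_forall fun p hp => ?_)
        rw [polarCoord_target] at hp
        have hp0 : 0 < p.1 := hp.1
        have hn : ‖Complex.polarCoord.symm p‖ = p.1 := by
          rw [Complex.norm_polarCoord_symm, abs_of_pos hp0]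
        by_cases h : p.1 < r
        · rw [Set.indicator_of_mem (by simpa [abs_of_pos hp0] using h),
            Set.indicator_of_mem (show p ∈ Set.Ioo 0 r ×ˢ Set.Ioo (-Real.pi) Real.pi from
              ⟨⟨hp0, h⟩, hp.2⟩), hn, smul_eq_mul,
            ← ENNReal.ofReal_mul hp0.le, mul_div_cancel₀ _ hp0.ne']
        · rw [Set.indicator_of_notMem (by simpa [abs_of_pos hp0] using h)]
          simp
    _ ≤ ∫⁻ p, (Set.Ioo 0 r ×ˢ Set.Ioo (-Real.pi) Real.pi).indicator
            (fun _ => ENNReal.ofReal r) p := setLIntegral_le_lintegral _ _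
    _ = ENNReal.ofReal (2 * Real.pi * r ^ 2) := by
        rw [lintegral_indicator_const (measurableSet_Ioo.prod measurableSet_Ioo),
          Measure.volume_eq_prod, Measure.prod_prod, Real.volume_Ioo, Real.volume_Ioo,
          ← ENNReal.ofReal_mul (by linarith), ← ENNReal.ofReal_mul hr.le]
        congr 1
        ring

/-- The pointwise splitting behind Hölder's inequality with exponents `1 + b` and
`(1 + b) / b`. -/
theorem mul_exp_neg_le_rpow_mul_rpow {b x y u L H : ℝ} (hb : 0 < b) (hx : 0 ≤ x) (hxy : x ≤ y)
    (hL : 0 < L) (hH : L ^ (2 / b) ≤ H) :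
    x * Real.exp (-u) ≤
      (x * Real.exp (-((1 + b) * u)) / L ^ 2) ^ (1 / (1 + b)) * (y * H) ^ (b / (1 + b)) := by
  have hb1 : 0 < 1 + b := by linarith
  have hsum : 1 / (1 + b) + b / (1 + b) = 1 := by field_simp
  have hE : Real.exp (-((1 + b) * u)) ^ (1 / (1 + b)) = Real.exp (-u) := by
    rw [← Real.exp_mul]
    congr 1
    field_simp
  have hL2 : (L ^ (2 / b)) ^ (b / (1 + b)) = (L ^ 2) ^ (1 / (1 + b)) := by
    rw [← Real.rpow_natCast L 2, ← Real.rpow_mul hL.le, ← Real.rpow_mul hL.le]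
    congr 1
    push_cast
    field_simp
  calc x * Real.exp (-u)
      = (x * Real.exp (-((1 + b) * u)) / L ^ 2) ^ (1 / (1 + b)) *
          (x * L ^ (2 / b)) ^ (b / (1 + b)) := by
        rw [Real.div_rpow (by positivity) (by positivity),
          Real.mul_rpow hx (by positivity), Real.mul_rpow hx (by positivity), hE, hL2]
        have hxx : x ^ (1 / (1 + b)) * x ^ (b / (1 + b)) = x := by
          rw [← Real.rpow_add_of_nonneg hx (by positivity) (by positivity), hsum, Real.rpow_one]
        have hne : (L ^ 2) ^ (1 / (1 + b)) ≠ 0 := by positivity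
        field_simp
        linear_combination -hxx
    _ ≤ _ := by
        have h0 : 0 ≤ y := hx.trans hxy
        gcongr

/-- **One-variable Hölder estimate (relations (4)–(6)).**
For every `ε₀ > 0` there is `C > 0` such that: for every `M ≥ 0`, every measurable
`g : ℂ → ℂ` with `|g| ≤ M` on the disc `{|z| < 1/2}`, every measurable `φ : ℂ → ℝ` for
which `A := ∫_{|z|<1/2} |g|² e^{−(1+ε₀)φ} / log²(1/|z|²) dλ` is finite, and every
`0 < ε ≤ 1/4`, one has
`∫_{|z|<ε} |g|² e^{−φ} dλ ≤ A^{1/(1+ε₀)} · (C·M²·ε²·(log(1/ε²))^{2/ε₀})^{ε₀/(1+ε₀)}`. -/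
theorem holder_concentration_estimate (ε₀ : ℝ) (hε₀ : 0 < ε₀) :
    ∃ C : ℝ, 0 < C ∧
      ∀ (M : ℝ), 0 ≤ M →
      ∀ (g : ℂ → ℂ), Measurable g → (∀ z : ℂ, ‖z‖ < 1 / 2 → ‖g z‖ ≤ M) →
      ∀ (φ : ℂ → ℝ), Measurable φ →
      ∀ A : ℝ≥0∞,
        A = ∫⁻ z in Metric.ball (0 : ℂ) (1 / 2),
              ENNReal.ofReal
                (‖g z‖ ^ 2 * Real.exp (-((1 + ε₀) * φ z)) / (Real.log (1 / ‖z‖ ^ 2)) ^ 2) →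
        A ≠ ⊤ →
      ∀ ε : ℝ, 0 < ε → ε ≤ 1 / 4 →
        (∫⁻ z in Metric.ball (0 : ℂ) ε, ENNReal.ofReal (‖g z‖ ^ 2 * Real.exp (-φ z)))
          ≤ A ^ (1 / (1 + ε₀)) *
            ENNReal.ofReal (C * M ^ 2 * ε ^ 2 * (Real.log (1 / ε ^ 2)) ^ (2 / ε₀))
              ^ (ε₀ / (1 + ε₀)) := by
  have hb1 : 0 < 1 + ε₀ := by linarith
  have ha : 0 < 2 / ε₀ := by positivity
  refine ⟨(1 + 2 * (2 / ε₀)) ^ (2 / ε₀) * (2 * Real.pi), by positivity, ?_⟩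
  intro M hM g hg hgM φ hφ A hA _ ε hε hε4
  set K := (1 + 2 * (2 / ε₀)) ^ (2 / ε₀)
  set Λ := Real.log (1 / ε ^ 2) ^ (2 / ε₀)
  have hK0 : 0 ≤ K := by positivity
  have hΛ0 : 0 ≤ Λ :=
    Real.rpow_nonneg (zero_le_one.trans (one_le_log_one_div_sq hε hε4)) _
  set F : ℂ → ℝ≥0∞ := fun z => ENNReal.ofReal
    (‖g z‖ ^ 2 * Real.exp (-((1 + ε₀) * φ z)) / (Real.log (1 / ‖z‖ ^ 2)) ^ 2) with hF
  set G : ℂ → ℝ≥0∞ := fun z => ENNReal.ofReal (M ^ 2 * (K * Λ * (ε / ‖z‖))) with hG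
  have hFm : Measurable F := by fun_prop
  have hGm : Measurable G := by fun_prop
  calc (∫⁻ z in Metric.ball (0 : ℂ) ε, ENNReal.ofReal (‖g z‖ ^ 2 * Real.exp (-φ z)))
      ≤ ∫⁻ z in Metric.ball (0 : ℂ) ε, F z ^ (1 / (1 + ε₀)) * G z ^ (ε₀ / (1 + ε₀)) := by
        refine setLIntegral_mono_ae' Metric.isOpen_ball.measurableSet ?_
        filter_upwards [Measure.ae_ne volume (0 : ℂ)] with z hz hzε
        rw [mem_ball_zero_iff] at hzε
        have hz0 : 0 < ‖z‖ := norm_pos_iff.2 hz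
        have hL : 0 < Real.log (1 / ‖z‖ ^ 2) :=
          zero_lt_one.trans_le (one_le_log_one_div_sq hz0 (by linarith))
        rw [hF, hG, ENNReal.ofReal_rpow_of_nonneg (by positivity) (by positivity),
          ENNReal.ofReal_rpow_of_nonneg (by positivity) (by positivity),
          ← ENNReal.ofReal_mul (by positivity)]
        refine ENNReal.ofReal_le_ofReal
          (mul_exp_neg_le_rpow_mul_rpow hε₀ (by positivity) ?_ hL
            (log_one_div_sq_rpow_le ha hz0 hzε.le hε4))
        have := hgM z (by linarith)
        gcongr
    _ ≤ (∫⁻ z in Metric.ball (0 : ℂ) ε, F z) ^ (1 / (1 + ε₀)) *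
          (∫⁻ z in Metric.ball (0 : ℂ) ε, G z) ^ (ε₀ / (1 + ε₀)) :=
        ENNReal.lintegral_mul_norm_pow_le hFm.aemeasurable hGm.aemeasurable
          (by positivity) (by positivity) (by field_simp)
    _ ≤ _ := by
        gcongr
        · rw [hA]
          exact lintegral_mono_set (Metric.ball_subset_ball (by linarith))
        · calc ∫⁻ z in Metric.ball (0 : ℂ) ε, G z
              = ENNReal.ofReal (M ^ 2 * (K * Λ)) *
                  ∫⁻ z in Metric.ball (0 : ℂ) ε, ENNReal.ofReal (ε / ‖z‖) := by
                rw [← lintegral_const_mul _ (by fun_prop)]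
                refine lintegral_congr fun z => ?_
                rw [← ENNReal.ofReal_mul (by positivity), hG, mul_assoc (M ^ 2)]
            _ ≤ ENNReal.ofReal (M ^ 2 * (K * Λ)) * ENNReal.ofReal (2 * Real.pi * ε ^ 2) := by
                gcongr
                exact lintegral_ball_inv_norm_le hε
            _ = _ := by
                rw [← ENNReal.ofReal_mul (by positivity)]
                congr 1
                ring
end
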